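/- arXiv:2207.04232 — 2 statements merged into one kernel-verified Lean document; each statement's English description precedes it below -/
import Mathlib

section
/- Let q be an odd prime power and let n ≥ 2 be an integer. If q > (t + (t^2 + (n−1)·2^{n−2})^{1/2})^2, where t = (n−3)·2^{n−3} + 1/2, then there exist n distinct elements α_1, …, α_n of F_q such that α_j − α_i is a nonzero square in F_q for all 1 ≤ i < j ≤ n. -/
open Finset

/-- The Euclidean dual of a linear code `C ⊆ F^n`. -/
def euclideanDual {F : Type*} [Field F] {n : ℕ} (C : Submodule F (Fin n → F)) :
    Submodule F (Fin n → F) where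
  carrier := {x | ∀ c ∈ C, ∑ i, x i * c i = 0}
  add_mem' := by
    intro a b ha hb c hc
    have h : ∑ i, (a + b) i * c i = (∑ i, a i * c i) + ∑ i, b i * c i := by
      rw [← Finset.sum_add_distrib]
      exact Finset.sum_congr rfl fun i _ => by simp [add_mul]
    simp only [Set.mem_setOf_eq] at *
    rw [h, ha c hc, hb c hc, add_zero]
  zero_mem' := by
    intro c hc
    simp
  smul_mem' := by
    intro r a ha c hc
    have h : ∑ i, (r • a) i * c i = r * ∑ i, a i * c i := by
      rw [Finset.mul_sum]
      exact Finset.sum_congr rfl fun i _ => by simp [mul_assoc]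
    simp only [Set.mem_setOf_eq] at *
    rw [h, ha c hc, mul_zero]

/-- Hamming weight of a word. -/
noncomputable def hWeight {F : Type*} [Field F] {n : ℕ} (c : Fin n → F) : ℕ := Nat.card {i : Fin n // c i ≠ 0}

/-- `C` is an MDS (Euclidean) self-dual code: it equals its Euclidean dual and its
minimum Hamming distance is `n/2 + 1`. -/
def IsMDSSelfDual {F : Type*} [Field F] {n : ℕ} (C : Submodule F (Fin n → F)) : Prop :=
  C = euclideanDual C ∧
  (∀ c ∈ C, c ≠ 0 → n / 2 + 1 ≤ hWeight c) ∧
  (∃ c ∈ C, c ≠ 0 ∧ hWeight c = n / 2 + 1)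

open Classical in
/-- The quadratic character `η` of a field: `1` on nonzero squares, `-1` on nonsquares,
`0` at `0`. -/
noncomputable def quadChar (F : Type*) [Field F] (x : F) : ℤ :=
  if x = 0 then 0 else if IsSquare x then 1 else -1

/-- An Erdős–Szekeres bound for arbitrary (not necessarily symmetric) relations: a large finite set
contains a long list that is pairwise related or a long list that is pairwise unrelated. -/
theorem exists_pairwise_list_of_choose_le_card {A : Type*} (r : A → A → Prop) (a b : ℕ)
    (S : Finset A) (hS : (a + b).choose a ≤ S.card) :
    (∃ l : List A, l.length = a + 1 ∧ (∀ x ∈ l, x ∈ S) ∧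
      l.Pairwise fun x y => x ≠ y ∧ r x y) ∨
    (∃ l : List A, l.length = b + 1 ∧ (∀ x ∈ l, x ∈ S) ∧
      l.Pairwise fun x y => x ≠ y ∧ ¬ r x y) := by
  classical
  obtain ⟨v, hv⟩ : S.Nonempty :=
    Finset.card_pos.mp ((Nat.choose_pos (Nat.le_add_right a b)).trans_le hS)
  induction hN : a + b generalizing a b S v with
  | zero =>
    obtain ⟨rfl, rfl⟩ : a = 0 ∧ b = 0 := by omega
    exact Or.inl ⟨[v], by simp [hv]⟩
  | succ N ih =>
    rcases a with _ | a
    · exact Or.inl ⟨[v], by simp [hv]⟩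
    rcases b with _ | b
    · exact Or.inr ⟨[v], by simp [hv]⟩
    set P := (S.erase v).filter (fun y => r v y) with hP
    set M := (S.erase v).filter (fun y => ¬ r v y) with hM
    have hcard : P.card + M.card + 1 = S.card := by
      rw [hP, hM, Finset.card_filter_add_card_filter_not, Finset.card_erase_add_one hv]
    have hchoose : (a + 1 + (b + 1)).choose (a + 1) =
        (a + (b + 1)).choose a + (a + 1 + b).choose (a + 1) := by
      rw [show a + 1 + (b + 1) = (a + b + 1) + 1 by ring, Nat.choose_succ_succ,
        show a + (b + 1) = a + b + 1 by ring, show a + 1 + b = a + b + 1 by ring]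
    have hcases : (a + (b + 1)).choose a ≤ P.card ∨ (a + 1 + b).choose (a + 1) ≤ M.card := by
      omega
    rcases hcases with h | h
    · obtain ⟨w, hw⟩ : P.Nonempty :=
        Finset.card_pos.mp ((Nat.choose_pos (Nat.le_add_right _ _)).trans_le h)
      rcases ih a (b + 1) P h w hw (by omega) with ⟨l, hl, hlP, hpair⟩ | ⟨l, hl, hlP, hpair⟩
      · refine Or.inl ⟨v :: l, by simp [hl], ?_, List.pairwise_cons.mpr ⟨?_, hpair⟩⟩ <;> grind
      · exact Or.inr ⟨l, hl, by grind, hpair⟩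
    · obtain ⟨w, hw⟩ : M.Nonempty :=
        Finset.card_pos.mp ((Nat.choose_pos (Nat.le_add_right _ _)).trans_le h)
      rcases ih (a + 1) b M h w hw (by omega) with ⟨l, hl, hlM, hpair⟩ | ⟨l, hl, hlM, hpair⟩
      · exact Or.inl ⟨l, hl, by grind, hpair⟩
      · refine Or.inr ⟨v :: l, by simp [hl], ?_, List.pairwise_cons.mpr ⟨?_, hpair⟩⟩ <;> grind

/-- Over a finite field some nonzero scalar turns all nonsquares into squares. -/
theorem exists_ne_zero_forall_isSquare_mul (F : Type*) [Field F] [Fintype F] :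
    ∃ g : F, g ≠ 0 ∧ ∀ x : F, ¬ IsSquare x → IsSquare (g * x) := by
  classical
  by_cases h : ∃ g : F, ¬ IsSquare g
  · obtain ⟨g, hg⟩ := h
    have hg0 : g ≠ 0 := by rintro rfl; exact hg (IsSquare.zero)
    refine ⟨g, hg0, fun x hx => ?_⟩
    have hx0 : x ≠ 0 := by rintro rfl; exact hx (IsSquare.zero)
    rw [← quadraticChar_one_iff_isSquare (mul_ne_zero hg0 hx0), map_mul,
      quadraticChar_neg_one_iff_not_isSquare.mpr hg,
      quadraticChar_neg_one_iff_not_isSquare.mpr hx]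
    norm_num
  · push Not at h
    exact ⟨1, one_ne_zero, fun x hx => absurd (h x) hx⟩

/-- A finite field with at least `(2m).choose m` elements contains `m + 1` distinct elements whose
differences, later minus earlier, are nonzero squares. -/
theorem exists_injective_isSquare_sub {F : Type*} [Field F] [Fintype F] (m : ℕ)
    (hF : (m + m).choose m ≤ Fintype.card F) :
    ∃ α : Fin (m + 1) → F, Function.Injective α ∧
      ∀ i j, i < j → α j - α i ≠ 0 ∧ IsSquare (α j - α i) := by
  suffices h : ∃ α : Fin (m + 1) → F, ∀ i j, i < j → α j - α i ≠ 0 ∧ IsSquare (α j - α i) by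
    obtain ⟨α, hα⟩ := h
    refine ⟨α, fun i j hij => ?_, hα⟩
    rcases lt_trichotomy i j with h | h | h
    · exact absurd (sub_eq_zero.mpr hij.symm) (hα i j h).1
    · exact h
    · exact absurd (sub_eq_zero.mpr hij) (hα j i h).1
  rcases exists_pairwise_list_of_choose_le_card (fun x y : F => IsSquare (y - x)) m m Finset.univ
    (by simpa using hF) with ⟨l, hl, -, hpair⟩ | ⟨l, hl, -, hpair⟩
  · rw [List.pairwise_iff_get] at hpair
    refine ⟨fun i => l.get (i.cast hl.symm), fun i j hij => ?_⟩
    obtain ⟨hne, hsq⟩ := hpair (i.cast hl.symm) (j.cast hl.symm) hij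
    exact ⟨sub_ne_zero.mpr hne.symm, hsq⟩
  · rw [List.pairwise_iff_get] at hpair
    obtain ⟨g, hg, hmul⟩ := exists_ne_zero_forall_isSquare_mul F
    refine ⟨fun i => g * l.get (i.cast hl.symm), fun i j hij => ?_⟩
    obtain ⟨hne, hsq⟩ := hpair (i.cast hl.symm) (j.cast hl.symm) hij
    rw [← mul_sub]
    exact ⟨mul_ne_zero hg (sub_ne_zero.mpr hne.symm), hmul _ hsq⟩

theorem four_mul_sq_add_le_add_sqrt_sq {t c : ℝ} (ht : 0 ≤ t) (hc : 0 ≤ c) :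
    4 * t ^ 2 + c ≤ (t + √(t ^ 2 + c)) ^ 2 := by
  have h1 := Real.sq_sqrt (by positivity : 0 ≤ t ^ 2 + c)
  have h2 : t ≤ √(t ^ 2 + c) := Real.le_sqrt_of_sq_le (by linarith)
  nlinarith

theorem stmt_18 (q n p k : ℕ) (hp : p.Prime) (hpodd : Odd p) (hq : q = p ^ k) (hk : 0 < k)
    (hn : 2 ≤ n)
    (hbound : (q : ℝ) >
      ((((n : ℝ) - 3) * 2 ^ ((n : ℤ) - 3) + 1 / 2) +
        Real.sqrt ((((n : ℝ) - 3) * 2 ^ ((n : ℤ) - 3) + 1 / 2) ^ 2 +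
          ((n : ℝ) - 1) * 2 ^ ((n : ℤ) - 2))) ^ 2)
    (F : Type*) [Field F] [Fintype F] (hF : Fintype.card F = q) :
    ∃ α : Fin n → F, Function.Injective α ∧
      ∀ i j : Fin n, i < j → α j - α i ≠ 0 ∧ IsSquare (α j - α i) := by
  obtain ⟨m, rfl⟩ : ∃ m, n = m + 1 := ⟨n - 1, by omega⟩
  refine exists_injective_isSquare_sub m ?_
  rw [hF]
  rcases Nat.lt_or_ge m 4 with hm | hm
  · have hlow := fun ht hc => (four_mul_sq_add_le_add_sqrt_sq ht hc).trans_lt hbound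
    interval_cases m
    · omega
    all_goals
      norm_num at hlow
      norm_num [Nat.choose]
      norm_cast at hlow <;> omega
  · obtain ⟨d, rfl⟩ : ∃ d, m = d + 4 := ⟨m - 4, by omega⟩
    rw [show ((d + 4 + 1 : ℕ) : ℤ) - 3 = ((d + 2 : ℕ) : ℤ) by push_cast; ring,
      show ((d + 4 + 1 : ℕ) : ℤ) - 2 = ((d + 3 : ℕ) : ℤ) by push_cast; ring,
      zpow_natCast, zpow_natCast] at hbound
    push_cast at hbound
    have hd : (0 : ℝ) ≤ d := d.cast_nonneg
    have hpow : (0 : ℝ) < 2 ^ (d + 2) := by positivity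
    have ht : (2 : ℝ) * 2 ^ (d + 2) ≤ ((d : ℝ) + 4 + 1 - 3) * 2 ^ (d + 2) + 1 / 2 := by
      nlinarith
    have hc : (0 : ℝ) ≤ ((d : ℝ) + 4 + 1 - 1) * 2 ^ (d + 3) := by
      apply mul_nonneg _ (by positivity)
      linarith
    have hlow := (four_mul_sq_add_le_add_sqrt_sq (by linarith) hc).trans_lt hbound
    have hsq := pow_le_pow_left₀ (by positivity) ht 2
    have hq' : ((2 ^ (d + 4 + (d + 4)) : ℕ) : ℝ) ≤ q := by
      push_cast
      calc (2 : ℝ) ^ (d + 4 + (d + 4)) = 4 * (2 * 2 ^ (d + 2)) ^ 2 := by ring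
        _ ≤ q := by linarith
    exact (Nat.choose_le_two_pow _ _).trans (by exact_mod_cast hq')
end

section
/- Let q be a prime power with q ≡ 1 (mod 4) and let n be an even integer with n ≥ 2 such that q > (t + (t^2 + (n−1)·2^{n−2})^{1/2})^2, where t = (n−3)·2^{n−3} + 1/2. Then there exists an MDS self-dual code over F_q of length n. -/
open Finset

/-- The Erdős–Szekeres bound: a symmetric relation on at least `(a + b).choose a` points has
a homogeneous set of size `a + 1`, or an antihomogeneous one of size `b + 1`. -/
theorem exists_pairwise_or_pairwise_not {α : Type*} {r : α → α → Prop}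
    (hr : ∀ x y, r x y → r y x) (a b : ℕ) (S : Finset α) (hS : (a + b).choose a ≤ #S) :
    (∃ T ⊆ S, #T = a + 1 ∧ (T : Set α).Pairwise r) ∨
      (∃ T ⊆ S, #T = b + 1 ∧ (T : Set α).Pairwise fun x y => ¬ r x y) := by
  classical
  have hne (m l : ℕ) (S : Finset α) (h : (m + l).choose m ≤ #S) : ∃ x, x ∈ S :=
    card_pos.mp ((Nat.choose_pos (Nat.le_add_right m l)).trans_le h)
  induction a generalizing b S with
  | zero =>
    obtain ⟨x, hx⟩ := hne _ _ _ hS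
    exact .inl ⟨{x}, by simpa using hx, by simp, by simp⟩
  | succ a iha =>
    induction b generalizing S with
    | zero =>
      obtain ⟨x, hx⟩ := hne _ _ _ hS
      exact .inr ⟨{x}, by simpa using hx, by simp, by simp⟩
    | succ b ihb =>
      obtain ⟨x, hx⟩ := hne _ _ _ hS
      have hsum := card_filter_add_card_filter_not (s := S.erase x) (fun y => r x y)
      rw [card_erase_of_mem hx] at hsum
      have hchoose : (a + 1 + (b + 1)).choose (a + 1) =
          (a + (b + 1)).choose a + (a + 1 + b).choose (a + 1) := by
        rw [show a + 1 + (b + 1) = (a + b + 1) + 1 by ring, Nat.choose_succ_succ',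
          show a + (b + 1) = a + b + 1 by ring, show a + 1 + b = a + b + 1 by ring]
      have hcases : (a + (b + 1)).choose a ≤ #{y ∈ S.erase x | r x y} ∨
          (a + 1 + b).choose (a + 1) ≤ #{y ∈ S.erase x | ¬ r x y} := by omega
      rcases hcases with h | h
      · rcases iha (b + 1) _ h with ⟨T, hTS, hT, hTr⟩ | ⟨T, hTS, hT⟩
        · refine .inl ⟨insert x T, ?_, ?_, ?_⟩
          · grind
          · rw [card_insert_of_notMem (by grind), hT]
          · rw [coe_insert]
            exact hTr.insert fun y hy _ =>
              have : r x y := (mem_filter.mp (hTS hy)).2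
              ⟨this, hr _ _ this⟩
        · exact .inr ⟨T, by grind, hT⟩
      · rcases ihb _ h with ⟨T, hTS, hT⟩ | ⟨T, hTS, hT, hTr⟩
        · exact .inl ⟨T, by grind, hT⟩
        · refine .inr ⟨insert x T, ?_, ?_, ?_⟩
          · grind
          · rw [card_insert_of_notMem (by grind), hT]
          · rw [coe_insert]
            exact hTr.insert fun y hy _ =>
              have : ¬ r x y := (mem_filter.mp (hTS hy)).2
              ⟨this, fun h => this (hr _ _ h)⟩

/-- The generalized Reed–Solomon code of dimension `m` with evaluation points `α` and column
multipliers `v`. -/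
noncomputable def grsCode {F : Type*} [Field F] {n : ℕ} (α v : Fin n → F) (m : ℕ) :
    Submodule F (Fin n → F) :=
  (Polynomial.degreeLT F m).map
    (LinearMap.pi fun i => v i • Polynomial.leval (α i))

section GRS

variable {F : Type*} [Field F] {n m : ℕ} {α v : Fin n → F}

theorem mem_grsCode {x : Fin n → F} :
    x ∈ grsCode α v m ↔
      ∃ f : Polynomial F, f.degree < m ∧ ∀ i, v i * f.eval (α i) = x i := by
  simp [grsCode, Polynomial.mem_degreeLT, funext_iff, Polynomial.leval]

theorem sum_grs_mul_grs (hα : Function.Injective α) {c : F}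
    (hv : ∀ i, v i ^ 2 = c / ∏ j ∈ univ.erase i, (α i - α j))
    {f g : Polynomial F} (hfg : (f * g).degree < n) :
    ∑ i, (v i * f.eval (α i)) * (v i * g.eval (α i)) = c * (f * g).coeff (n - 1) := by
  have h := Lagrange.coeff_eq_sum (s := univ) (v := α) hα.injOn (P := f * g)
    (by simpa using hfg)
  rw [card_univ, Fintype.card_fin] at h
  rw [h, mul_sum]
  refine sum_congr rfl fun i _ => ?_
  rw [Polynomial.eval_mul]
  linear_combination (f.eval (α i) * g.eval (α i)) * hv i

theorem hWeight_eq (x : Fin n → F) [DecidableEq F] : hWeight x = n - #{i | x i = 0} := by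
  have h := card_filter_add_card_filter_not (s := (univ : Finset (Fin n))) (fun i => x i = 0)
  rw [card_univ, Fintype.card_fin] at h
  rw [hWeight, Nat.card_eq_fintype_card, Fintype.card_subtype]
  simp only [ne_eq] at *
  omega

theorem grsCode_eq_euclideanDual (hα : Function.Injective α) (hn : n = m + m) {c : F}
    (hc : c ≠ 0) (hv0 : ∀ i, v i ≠ 0)
    (hv : ∀ i, v i ^ 2 = c / ∏ j ∈ univ.erase i, (α i - α j)) :
    grsCode α v m = euclideanDual (grsCode α v m) := by
  ext x
  constructor
  · intro hx y hy
    obtain ⟨f, hf, hfx⟩ := mem_grsCode.mp hx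
    obtain ⟨g, hg, hgy⟩ := mem_grsCode.mp hy
    simp only [← hfx, ← hgy]
    rcases eq_or_ne f 0 with rfl | hf0
    · simp
    rcases eq_or_ne g 0 with rfl | hg0
    · simp
    have hf' := (Polynomial.natDegree_lt_iff_degree_lt hf0).mpr hf
    have hg' := (Polynomial.natDegree_lt_iff_degree_lt hg0).mpr hg
    have hdeg : (f * g).natDegree < n - 1 := by
      rw [Polynomial.natDegree_mul hf0 hg0]; omega
    rw [sum_grs_mul_grs hα hv, Polynomial.coeff_eq_zero_of_natDegree_lt hdeg, mul_zero]
    rw [← Polynomial.natDegree_lt_iff_degree_lt (mul_ne_zero hf0 hg0)]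
    omega
  · intro hx
    set f := Lagrange.interpolate univ α fun i => x i / v i with hf
    have hfx (i : Fin n) : v i * f.eval (α i) = x i := by
      rw [hf, Lagrange.eval_interpolate_at_node _ hα.injOn (mem_univ i), mul_div_cancel₀ _ (hv0 i)]
    have hfdeg : f.degree < n := by
      have h := Lagrange.degree_interpolate_lt (s := univ) (fun i => x i / v i) hα.injOn
      rwa [card_univ, Fintype.card_fin] at h
    refine mem_grsCode.mpr ⟨f, ?_, hfx⟩
    rcases eq_or_ne f 0 with hf0 | hf0
    · rw [hf0, Polynomial.degree_zero]; exact WithBot.bot_lt_coe m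
    rw [← Polynomial.natDegree_lt_iff_degree_lt hf0] at hfdeg ⊢
    by_contra! hm
    set d := n - 1 - f.natDegree
    have hX : (Polynomial.X ^ d : Polynomial F) ≠ 0 := pow_ne_zero _ Polynomial.X_ne_zero
    have hy : (fun i => v i * (Polynomial.X ^ d : Polynomial F).eval (α i)) ∈ grsCode α v m :=
      mem_grsCode.mpr ⟨Polynomial.X ^ d, by
        rw [Polynomial.degree_X_pow]; exact_mod_cast (by omega : d < m), fun _ => rfl⟩
    have h0 : ∑ i, x i * (v i * (Polynomial.X ^ d : Polynomial F).eval (α i)) = 0 := hx _ hy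
    simp only [← hfx] at h0
    rw [sum_grs_mul_grs hα hv] at h0
    · rw [show n - 1 = f.natDegree + d by omega, Polynomial.coeff_mul_X_pow,
        Polynomial.coeff_natDegree] at h0
      exact mul_ne_zero hc (Polynomial.leadingCoeff_ne_zero.mpr hf0) h0
    · rw [← Polynomial.natDegree_lt_iff_degree_lt (mul_ne_zero hf0 hX),
        Polynomial.natDegree_mul hf0 hX, Polynomial.natDegree_X_pow]
      omega

theorem le_hWeight_of_mem_grsCode (hα : Function.Injective α) (hmn : m ≤ n)
    (hv0 : ∀ i, v i ≠ 0) {x : Fin n → F} (hx : x ∈ grsCode α v m) (hx0 : x ≠ 0) :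
    n - m + 1 ≤ hWeight x := by
  classical
  obtain ⟨f, hf, hfx⟩ := mem_grsCode.mp hx
  have hf0 : f ≠ 0 := by
    rintro rfl
    exact hx0 (funext fun i => by simp [← hfx])
  rw [← Polynomial.natDegree_lt_iff_degree_lt hf0] at hf
  have hroots : #{i | x i = 0} ≤ f.natDegree := by
    rw [← card_image_of_injective _ hα]
    refine Polynomial.card_le_degree_of_subset_roots fun z hz => ?_
    obtain ⟨i, hi, rfl⟩ := mem_image.mp (mem_val.mp hz)
    rw [mem_filter, ← hfx] at hi
    exact (Polynomial.mem_roots hf0).mpr ((mul_eq_zero.mp hi.2).resolve_left (hv0 i))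
  rw [hWeight_eq]
  omega

theorem exists_hWeight_eq_of_mem_grsCode (hα : Function.Injective α) (hm : 0 < m) (hmn : m ≤ n)
    (hv0 : ∀ i, v i ≠ 0) :
    ∃ x ∈ grsCode α v m, x ≠ 0 ∧ hWeight x = n - m + 1 := by
  classical
  obtain ⟨s, -, hs⟩ := exists_subset_card_eq (s := (univ : Finset (Fin n))) (n := m - 1)
    (by rw [card_univ, Fintype.card_fin]; omega)
  set f := Lagrange.nodal s α
  have hzero (i : Fin n) : v i * f.eval (α i) = 0 ↔ i ∈ s := by
    rw [mul_eq_zero, or_iff_right (hv0 i), Lagrange.eval_nodal, prod_eq_zero_iff]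
    constructor
    · rintro ⟨j, hj, h⟩
      rwa [hα (sub_eq_zero.mp h)]
    · exact fun h => ⟨i, h, sub_self _⟩
  have hweight : hWeight (fun i => v i * f.eval (α i)) = n - m + 1 := by
    rw [hWeight_eq]
    simp only [hzero, filter_univ_mem, hs]
    omega
  refine ⟨_, mem_grsCode.mpr ⟨f, ?_, fun _ => rfl⟩, ?_, hweight⟩
  · rw [Lagrange.degree_nodal, hs]
    exact_mod_cast Nat.sub_lt hm one_pos
  · intro h
    rw [h] at hweight
    simp [hWeight] at hweight

theorem isMDSSelfDual_grsCode (hα : Function.Injective α) (hm : 0 < m) (hn : n = m + m) {c : F}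
    (hc : c ≠ 0) (hv0 : ∀ i, v i ≠ 0)
    (hv : ∀ i, v i ^ 2 = c / ∏ j ∈ univ.erase i, (α i - α j)) :
    IsMDSSelfDual (grsCode α v m) := by
  have hhalf : n / 2 = n - m := by omega
  rw [IsMDSSelfDual, hhalf]
  exact ⟨grsCode_eq_euclideanDual hα hn hc hv0 hv,
    fun x hx hx0 => le_hWeight_of_mem_grsCode hα (by omega) hv0 hx hx0,
    exists_hWeight_eq_of_mem_grsCode hα hm (by omega) hv0⟩

/-- Evaluation points whose differences all lie in one square class give an MDS self-dual
code. -/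
theorem exists_isMDSSelfDual_of_isSquare_div (hα : Function.Injective α) (hm : 0 < m)
    (hn : n = m + m) {d : F} (hd : d ≠ 0) (hsq : ∀ i j, i ≠ j → IsSquare (d / (α i - α j))) :
    ∃ C : Submodule F (Fin n → F), IsMDSSelfDual C := by
  have hprod (i : Fin n) : ∏ j ∈ univ.erase i, (α i - α j) ≠ 0 :=
    prod_ne_zero_iff.mpr fun j hj => sub_ne_zero.mpr fun h => ne_of_mem_erase hj (hα h).symm
  have hv (i : Fin n) : ∃ w, w ^ 2 = d ^ (n - 1) / ∏ j ∈ univ.erase i, (α i - α j) := by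
    have h : IsSquare (∏ j ∈ univ.erase i, d / (α i - α j)) :=
      isSquare_prod _ fun j hj => hsq i j (ne_of_mem_erase hj).symm
    rw [prod_div_distrib, prod_const, card_erase_of_mem (mem_univ i), card_univ,
      Fintype.card_fin] at h
    obtain ⟨w, hw⟩ := h
    exact ⟨w, by rw [hw, sq]⟩
  choose v hv using hv
  refine ⟨_, isMDSSelfDual_grsCode hα hm hn (pow_ne_zero (n - 1) hd) (fun i => ?_) hv⟩
  rw [← pow_ne_zero_iff two_ne_zero, hv]
  exact div_ne_zero (pow_ne_zero _ hd) (hprod i)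

end GRS

/-- In a finite field, the quotient of two nonsquares is a square. -/
theorem isSquare_div_of_not_isSquare {F : Type*} [Field F] [Fintype F] {a b : F}
    (ha : ¬IsSquare a) (hb : ¬IsSquare b) : IsSquare (a / b) := by
  classical
  have ha0 : a ≠ 0 := by rintro rfl; exact ha IsSquare.zero
  have hb0 : b ≠ 0 := by rintro rfl; exact hb IsSquare.zero
  have hab : IsSquare (a * b) := by
    rw [← quadraticChar_one_iff_isSquare (mul_ne_zero ha0 hb0), map_mul,
      quadraticChar_neg_one_iff_not_isSquare.mpr ha,
      quadraticChar_neg_one_iff_not_isSquare.mpr hb]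
    norm_num
  rw [show a / b = a * b * (b⁻¹ * b⁻¹) by field_simp]
  exact hab.mul (IsSquare.mul_self _)

/-- A field of size at least `(n - 1).centralBinom` in which `-1` is a square has an MDS
self-dual code of even length `n`. -/
theorem exists_isMDSSelfDual_of_centralBinom_le {F : Type*} [Field F] [Fintype F] {n : ℕ}
    (hn : 2 ≤ n) (hneven : Even n) (hneg : IsSquare (-1 : F))
    (hcard : (n - 1).centralBinom ≤ Fintype.card F) :
    ∃ C : Submodule F (Fin n → F), IsMDSSelfDual C := by
  obtain ⟨m, hm⟩ := hneven
  have hsymm (x y : F) (h : IsSquare (x - y)) : IsSquare (y - x) := by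
    rw [← neg_sub x y, ← neg_one_mul]
    exact hneg.mul h
  have hpoints (T : Finset F) (hT : #T = n) (d : F) (hd : d ≠ 0)
      (h : ∀ x ∈ T, ∀ y ∈ T, x ≠ y → IsSquare (d / (x - y))) :
      ∃ C : Submodule F (Fin n → F), IsMDSSelfDual C := by
    let e := (T.equivFinOfCardEq hT).symm
    have he : Function.Injective fun i => (e i : F) := Subtype.val_injective.comp e.injective
    exact exists_isMDSSelfDual_of_isSquare_div he (by omega) hm hd fun i j hij =>
      h _ (e i).2 _ (e j).2 (he.ne hij)
  rw [Nat.centralBinom_eq_two_mul_choose, two_mul, ← card_univ] at hcard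
  rcases exists_pairwise_or_pairwise_not hsymm _ _ univ hcard with
    ⟨T, -, hT, hTr⟩ | ⟨T, -, hT, hTr⟩
  · refine hpoints T (by omega) 1 one_ne_zero fun x hx y hy hxy => ?_
    rw [one_div, isSquare_inv]
    exact hTr hx hy hxy
  · obtain ⟨x, hx, y, hy, hxy⟩ := one_lt_card.mp (by omega : 1 < #T)
    refine hpoints T (by omega) (x - y) (sub_ne_zero.mpr hxy) fun z hz w hw hzw => ?_
    exact isSquare_div_of_not_isSquare (hTr hx hy hxy) (hTr hz hw hzw)

/-- The Weil-type bound on `q` exceeds the Erdős–Szekeres bound. -/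
theorem centralBinom_le_of_lt {q n : ℕ} (hn : 4 ≤ n)
    (hbound : (q : ℝ) >
      ((((n : ℝ) - 3) * 2 ^ ((n : ℤ) - 3) + 1 / 2) +
        Real.sqrt ((((n : ℝ) - 3) * 2 ^ ((n : ℤ) - 3) + 1 / 2) ^ 2 +
          ((n : ℝ) - 1) * 2 ^ ((n : ℤ) - 2))) ^ 2) :
    (n - 1).centralBinom ≤ q := by
  obtain ⟨m, rfl⟩ := Nat.exists_eq_add_of_le' hn
  set t : ℝ := (((m + 4 : ℕ) : ℝ) - 3) * 2 ^ (((m + 4 : ℕ) : ℤ) - 3) + 1 / 2 with ht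
  have ht' : t = (m + 1) * 2 ^ (m + 1) + 1 / 2 := by
    rw [ht, show ((m + 4 : ℕ) : ℤ) - 3 = ((m + 1 : ℕ) : ℤ) by push_cast; ring, zpow_natCast]
    push_cast
    ring
  have ht0 : 0 ≤ t := by rw [ht']; positivity
  have hsqrt : t ≤ √(t ^ 2 + (((m + 4 : ℕ) : ℝ) - 1) * 2 ^ (((m + 4 : ℕ) : ℤ) - 2)) := by
    refine Real.le_sqrt_of_sq_le (le_add_of_nonneg_right (mul_nonneg ?_ (by positivity)))
    push_cast
    linarith [(Nat.cast_nonneg m : (0 : ℝ) ≤ m)]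
  have hlt : (2 * t) ^ 2 < q := lt_of_le_of_lt (by gcongr; linarith) hbound
  rw [show m + 4 - 1 = m + 3 by omega]
  have hpow : ((m + 1) * 2 ^ (m + 2) + 1) ^ 2 < q := by
    have h2t : 2 * t = (m + 1) * 2 ^ (m + 2) + 1 := by rw [ht']; ring
    rw [h2t] at hlt
    exact_mod_cast hlt
  rcases Nat.eq_zero_or_pos m with rfl | hm
  · have : Nat.centralBinom 3 = 20 := by decide
    norm_num at *
    omega
  · refine (Nat.centralBinom_le_four_pow (m + 3)).trans (le_trans ?_ hpow.le)
    calc 4 ^ (m + 3) = (2 * 2 ^ (m + 2)) ^ 2 := by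
          rw [show 4 = 2 ^ 2 by rfl, ← pow_mul]; ring
      _ ≤ ((m + 1) * 2 ^ (m + 2) + 1) ^ 2 := by
          gcongr
          exact (Nat.mul_le_mul_right _ (by omega)).trans (Nat.le_succ _)

theorem stmt_19 (q n p k : ℕ) (hp : p.Prime) (hq : q = p ^ k) (hk : 0 < k)
    (hq4 : q % 4 = 1) (hn : 2 ≤ n) (hneven : Even n)
    (hbound : (q : ℝ) >
      ((((n : ℝ) - 3) * 2 ^ ((n : ℤ) - 3) + 1 / 2) +
        Real.sqrt ((((n : ℝ) - 3) * 2 ^ ((n : ℤ) - 3) + 1 / 2) ^ 2 +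
          ((n : ℝ) - 1) * 2 ^ ((n : ℤ) - 2))) ^ 2)
    (F : Type*) [Field F] [Fintype F] (hF : Fintype.card F = q) :
    ∃ C : Submodule F (Fin n → F), IsMDSSelfDual C := by
  have hneg : IsSquare (-1 : F) := FiniteField.isSquare_neg_one_iff.mpr (by omega)
  refine exists_isMDSSelfDual_of_centralBinom_le hn hneven hneg ?_
  rcases hn.eq_or_lt with rfl | hn2
  · rw [show Nat.centralBinom (2 - 1) = 2 by decide]
    exact Fintype.one_lt_card
  · obtain ⟨m, hm⟩ := hneven
    rw [hF]
    exact centralBinom_le_of_lt (by omega) hbound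
end
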